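/- Fix D ∈ ℍ^{m×n}, Ω ⊆ Fin m × Fin n, λ > 0, and set λ₀ = min(λ, 1). Let Z^k = (A^k, B^k, X^k) satisfy the LRQD recurrences (X^k_{ij} = D_{ij} on Ω and = (A^k·B^k)_{ij} off Ω; A^{k+1} = (X^k·(B^k)ᴴ + λ·A^k)·(B^k·(B^k)ᴴ + λ·I)⁻¹; B^{k+1} = ((A^{k+1})ᴴ·A^{k+1} + λ·I)⁻¹·((A^{k+1})ᴴ·X^k + λ·B^k)), and let f(A,B,X) = ½‖A·B − X‖_F². Let Z# = (A#, B#, X#) be the limit of a convergent subsequence of {Z^k}. Suppose η > 0 satisfies ‖Z^k − Z^{k+1}‖ ≥ η·G(Z^k) for all k, and suppose θ ∈ [1/2, 1), μ > 0 and ρ > 0 are such that: (i) for every triple Z = (A,B,X) with X_{ij} = D_{ij} on Ω and ‖Z − Z#‖ ≤ ρ, |f(Z) − f(Z#)|^θ ≤ μ·G(Z); and (ii) ρ > (2μ/(λ₀·η·(1−θ)))·|f(Z⁰) − f(Z#)|^{1−θ} + ‖Z⁰ − Z#‖. Then ‖Z^k − Z#‖ ≤ ρ for all k, and ∑_{k=0}^∞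 ‖Z^k − Z^{k+1}‖ ≤ (2μ/(λ₀·η·(1−θ)))·|f(Z⁰) − f(Z#)|^{1−θ}. -/

import Mathlib

open scoped Quaternion Matrix
open Filter

/-- The Frobenius norm of a quaternion matrix. -/
noncomputable def frob {m n : ℕ} (A : Matrix (Fin m) (Fin n) ℍ[ℝ]) : ℝ :=
  Real.sqrt (∑ i, ∑ j, ‖A i j‖ ^ 2)

/-- The norm of a triple (A, B, X). -/
noncomputable def tnorm {m r n : ℕ} (A : Matrix (Fin m) (Fin r) ℍ[ℝ])
    (B : Matrix (Fin r) (Fin n) ℍ[ℝ]) (X : Matrix (Fin m) (Fin n) ℍ[ℝ]) : ℝ :=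
  Real.sqrt (frob A ^ 2 + frob B ^ 2 + frob X ^ 2)

/-- The projected-gradient norm G(A,B,X). -/
noncomputable def pgnorm {m r n : ℕ} (Ω : Set (Fin m × Fin n)) [DecidablePred (· ∈ Ω)]
    (A : Matrix (Fin m) (Fin r) ℍ[ℝ]) (B : Matrix (Fin r) (Fin n) ℍ[ℝ])
    (X : Matrix (Fin m) (Fin n) ℍ[ℝ]) : ℝ :=
  Real.sqrt (frob ((A * B - X) * Bᴴ) ^ 2 + frob (Aᴴ * (A * B - X)) ^ 2 +
    ∑ p : Fin m × Fin n, if p ∈ Ω then 0 else ‖(X - A * B) p.1 p.2‖ ^ 2)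

noncomputable def qip {m n : ℕ} (A B : Matrix (Fin m) (Fin n) ℍ[ℝ]) : ℝ :=
  ∑ i, ∑ j, inner ℝ (A i j) (B i j)

lemma frob_sq {m n : ℕ} (A : Matrix (Fin m) (Fin n) ℍ[ℝ]) :
    frob A ^ 2 = ∑ i, ∑ j, ‖A i j‖ ^ 2 := by
  unfold frob
  exact Real.sq_sqrt (by positivity)

lemma frob_add_sq {m n : ℕ} (A B : Matrix (Fin m) (Fin n) ℍ[ℝ]) :
    frob (A + B) ^ 2 = frob A ^ 2 + 2 * qip B A + frob B ^ 2 := by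
  simp only [frob_sq, qip, Finset.mul_sum, ← Finset.sum_add_distrib]
  refine Finset.sum_congr rfl fun i _ => Finset.sum_congr rfl fun j _ => ?_
  rw [Matrix.add_apply, norm_add_sq_real, real_inner_comm]

lemma qip_self {m n : ℕ} (A : Matrix (Fin m) (Fin n) ℍ[ℝ]) : qip A A = frob A ^ 2 := by
  simp only [frob_sq, qip, real_inner_self_eq_norm_sq]

lemma qip_smul {m n : ℕ} (c : ℝ) (A B : Matrix (Fin m) (Fin n) ℍ[ℝ]) :
    qip A (c • B) = c * qip A B := by
  simp only [qip, Finset.mul_sum, Matrix.smul_apply, real_inner_smul_right]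

lemma qip_add {m n : ℕ} (A B C : Matrix (Fin m) (Fin n) ℍ[ℝ]) :
    qip A (B + C) = qip A B + qip A C := by
  simp only [qip, Matrix.add_apply, inner_add_right, Finset.sum_add_distrib]

lemma qip_zero {m n : ℕ} (A : Matrix (Fin m) (Fin n) ℍ[ℝ]) : qip A 0 = 0 := by
  simp [qip]

lemma qip_mul_left {m r n : ℕ} (A : Matrix (Fin m) (Fin r) ℍ[ℝ])
    (B : Matrix (Fin r) (Fin n) ℍ[ℝ]) (C : Matrix (Fin m) (Fin n) ℍ[ℝ]) :
    qip (A * B) C = qip A (C * Bᴴ) := by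
  simp only [qip, Matrix.mul_apply, sum_inner, inner_sum, Matrix.conjTranspose_apply]
  refine Finset.sum_congr rfl fun i _ => ?_
  rw [Finset.sum_comm]
  refine Finset.sum_congr rfl fun k _ => Finset.sum_congr rfl fun j _ => ?_
  simp [Quaternion.inner_def, mul_assoc]

lemma qip_mul_right {m r n : ℕ} (A : Matrix (Fin m) (Fin r) ℍ[ℝ])
    (B : Matrix (Fin r) (Fin n) ℍ[ℝ]) (C : Matrix (Fin m) (Fin n) ℍ[ℝ]) :
    qip (A * B) C = qip B (Aᴴ * C) := by
  simp only [qip, Matrix.mul_apply, sum_inner, inner_sum, Matrix.conjTranspose_apply]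
  rw [Finset.sum_comm]
  have : ∀ j : Fin n, ∑ i, ∑ k, inner ℝ (A i k * B k j) (C i j)
      = ∑ k, ∑ i, inner ℝ (B k j) (star (A i k) * C i j) := by
    intro j
    rw [Finset.sum_comm]
    refine Finset.sum_congr rfl fun k _ => Finset.sum_congr rfl fun i _ => ?_
    simp only [Quaternion.inner_def, star_mul, star_star]
    simp; ring
  simp only [this]
  rw [Finset.sum_comm]

lemma frob_eq_zero {m n : ℕ} {A : Matrix (Fin m) (Fin n) ℍ[ℝ]} (h : frob A ^ 2 = 0) : A = 0 := by
  rw [frob_sq, Finset.sum_eq_zero_iff_of_nonneg (fun _ _ => by positivity)] at h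
  ext1 i j
  have h1 := h i (Finset.mem_univ _)
  rw [Finset.sum_eq_zero_iff_of_nonneg (fun _ _ => by positivity)] at h1
  have h2 := h1 j (Finset.mem_univ _)
  simpa using h2

lemma unit_aux {s r : ℕ} (P : Matrix (Fin s) (Fin r) ℍ[ℝ]) (lam : ℝ) (hlam : 0 < lam) :
    IsUnit (Pᴴ * P + lam • (1 : Matrix (Fin r) (Fin r) ℍ[ℝ])) := by
  set M := Pᴴ * P + lam • (1 : Matrix (Fin r) (Fin r) ℍ[ℝ]) with hM
  have hinj : Function.Injective (LinearMap.mulLeft ℝ M) := by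
    rw [← LinearMap.ker_eq_bot, LinearMap.ker_eq_bot']
    intro C hC
    have hC' : M * C = 0 := hC
    have h1 : qip C (M * C) = frob (P * C) ^ 2 + lam * frob C ^ 2 := by
      rw [hM, add_mul, qip_add, Matrix.mul_assoc, ← qip_mul_right, qip_self, smul_mul_assoc,
        qip_smul, one_mul, qip_self]
    rw [hC', qip_zero] at h1
    apply frob_eq_zero
    have h2 := sq_nonneg (frob (P * C))
    have h3 := sq_nonneg (frob C)
    nlinarith
  obtain ⟨N, hN⟩ := (LinearMap.injective_iff_surjective.mp hinj) 1
  exact IsUnit.of_mul_eq_one N hN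

lemma decA {m r n : ℕ} (A A' : Matrix (Fin m) (Fin r) ℍ[ℝ])
    (B : Matrix (Fin r) (Fin n) ℍ[ℝ]) (X : Matrix (Fin m) (Fin n) ℍ[ℝ]) (lam : ℝ) (hlam : 0 < lam)
    (h : A' = (X * Bᴴ + lam • A) *
      Ring.inverse (B * Bᴴ + lam • (1 : Matrix (Fin r) (Fin r) ℍ[ℝ]))) :
    frob (A' * B - X) ^ 2 + 2 * lam * frob (A - A') ^ 2 ≤ frob (A * B - X) ^ 2 := by
  have hu := unit_aux Bᴴ lam hlam
  rw [Matrix.conjTranspose_conjTranspose] at hu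
  have h1 : A' * (B * Bᴴ + lam • (1 : Matrix (Fin r) (Fin r) ℍ[ℝ])) = X * Bᴴ + lam • A := by
    rw [h, Matrix.mul_assoc, Ring.inverse_mul_cancel _ hu, Matrix.mul_one]
  have h2 : (A' * B - X) * Bᴴ = lam • (A - A') := by
    rw [Matrix.mul_add, Matrix.mul_smul, Matrix.mul_one, ← Matrix.mul_assoc] at h1
    rw [Matrix.sub_mul, smul_sub, sub_eq_sub_iff_add_eq_add, h1, add_comm]
  have h3 : A * B - X = (A' * B - X) + (A - A') * B := by
    rw [Matrix.sub_mul]; abel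
  rw [h3, frob_add_sq, qip_mul_left, h2, qip_smul, qip_self]
  nlinarith [sq_nonneg (frob ((A - A') * B))]

lemma decB {m r n : ℕ} (A : Matrix (Fin m) (Fin r) ℍ[ℝ])
    (B B' : Matrix (Fin r) (Fin n) ℍ[ℝ]) (X : Matrix (Fin m) (Fin n) ℍ[ℝ]) (lam : ℝ)
    (hlam : 0 < lam)
    (h : B' = Ring.inverse (Aᴴ * A + lam • (1 : Matrix (Fin r) (Fin r) ℍ[ℝ])) *
      (Aᴴ * X + lam • B)) :
    frob (A * B' - X) ^ 2 + 2 * lam * frob (B - B') ^ 2 ≤ frob (A * B - X) ^ 2 := by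
  have hu := unit_aux A lam hlam
  have h1 : (Aᴴ * A + lam • (1 : Matrix (Fin r) (Fin r) ℍ[ℝ])) * B' = Aᴴ * X + lam • B := by
    rw [h, ← Matrix.mul_assoc, Ring.mul_inverse_cancel _ hu, Matrix.one_mul]
  have h2 : Aᴴ * (A * B' - X) = lam • (B - B') := by
    rw [Matrix.add_mul, Matrix.smul_mul, Matrix.one_mul, Matrix.mul_assoc] at h1
    rw [Matrix.mul_sub, smul_sub, sub_eq_sub_iff_add_eq_add, h1, add_comm]
  have h3 : A * B - X = (A * B' - X) + A * (B - B') := by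
    rw [Matrix.mul_sub]; abel
  rw [h3, frob_add_sq, qip_mul_right, h2, qip_smul, qip_self]
  nlinarith [sq_nonneg (frob (A * (B - B')))]

lemma decX {m n : ℕ} (D : Matrix (Fin m) (Fin n) ℍ[ℝ]) (Ω : Set (Fin m × Fin n))
    (P X X' : Matrix (Fin m) (Fin n) ℍ[ℝ])
    (h1 : ∀ p ∈ Ω, X p.1 p.2 = D p.1 p.2) (h2 : ∀ p ∈ Ω, X' p.1 p.2 = D p.1 p.2)
    (h3 : ∀ p : Fin m × Fin n, p ∉ Ω → X' p.1 p.2 = P p.1 p.2) :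
    frob (P - X') ^ 2 + frob (X - X') ^ 2 ≤ frob (P - X) ^ 2 := by
  simp only [frob_sq, ← Finset.sum_add_distrib]
  refine Finset.sum_le_sum fun i _ => Finset.sum_le_sum fun j _ => ?_
  simp only [Matrix.sub_apply]
  by_cases hp : (i, j) ∈ Ω
  · have a := h1 _ hp
    have b := h2 _ hp
    simp only at a b
    rw [a, b]; simp
  · have a := h3 _ hp
    simp only at a
    rw [a, norm_sub_rev (X i j)]; simp

def tvec {m r n : ℕ} (A : Matrix (Fin m) (Fin r) ℍ[ℝ])
    (B : Matrix (Fin r) (Fin n) ℍ[ℝ]) (X : Matrix (Fin m) (Fin n) ℍ[ℝ]) :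
    PiLp 2 (fun _ : (Fin m × Fin r) ⊕ (Fin r × Fin n) ⊕ (Fin m × Fin n) => ℍ[ℝ]) :=
  WithLp.toLp 2 (Sum.elim (fun p => A p.1 p.2) (Sum.elim (fun p => B p.1 p.2) (fun p => X p.1 p.2)))

lemma tnorm_eq {m r n : ℕ} (A : Matrix (Fin m) (Fin r) ℍ[ℝ])
    (B : Matrix (Fin r) (Fin n) ℍ[ℝ]) (X : Matrix (Fin m) (Fin n) ℍ[ℝ]) :
    tnorm A B X = ‖tvec A B X‖ := by
  rw [PiLp.norm_eq_of_L2]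
  simp [tnorm, tvec, frob_sq, Fintype.sum_prod_type, add_assoc]

lemma tvec_sub {m r n : ℕ} (A A' : Matrix (Fin m) (Fin r) ℍ[ℝ])
    (B B' : Matrix (Fin r) (Fin n) ℍ[ℝ]) (X X' : Matrix (Fin m) (Fin n) ℍ[ℝ]) :
    tvec (A - A') (B - B') (X - X') = tvec A B X - tvec A' B' X' := by
  ext1 p
  rcases p with p | p | p <;> simp [tvec]

lemma kl_scalar {e e' d c K θ : ℝ} (he : 0 ≤ e') (hee : c * d ^ 2 ≤ e - e') (hc : 0 < c)
    (hd : 0 ≤ d) (hK : 0 < K) (hθ : 1 / 2 ≤ θ ∧ θ < 1) (hkl : e ^ θ ≤ K * d) :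
    d ≤ K / (c * (1 - θ)) * (e ^ (1 - θ) - e' ^ (1 - θ)) := by
  have hle : e' ≤ e := by nlinarith [mul_nonneg hc.le (sq_nonneg d)]
  have he0 : 0 ≤ e := he.trans hle
  have h1θ : 0 < 1 - θ := by linarith [hθ.2]
  have hP : 0 ≤ e ^ (1 - θ) - e' ^ (1 - θ) :=
    sub_nonneg.2 (Real.rpow_le_rpow he hle h1θ.le)
  have hcoef : 0 < K / (c * (1 - θ)) := by positivity
  rcases hd.eq_or_lt with hd0 | hd0
  · rw [← hd0]; positivity
  have h1 := Real.geom_mean_le_arith_mean2_weighted h1θ.le (by linarith [hθ.1] : 0 ≤ θ) he he0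
    (by ring)
  have h2 : e ^ (1 - θ) * e ^ θ = e := by
    rw [← Real.rpow_add' he0 (by norm_num)]; simp
  have h3 : (1 - θ) * (e - e') ≤ e ^ θ * (e ^ (1 - θ) - e' ^ (1 - θ)) := by nlinarith
  have h4 := mul_le_mul_of_nonneg_right hkl hP
  have h5 := mul_le_mul_of_nonneg_left hee h1θ.le
  have h6 : d * (c * (1 - θ) * d) ≤ d * (K * (e ^ (1 - θ) - e' ^ (1 - θ))) := by nlinarith
  have h7 := le_of_mul_le_mul_left h6 hd0
  rw [div_mul_eq_mul_div, le_div_iff₀ (by positivity)]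
  linarith

lemma kl_abstract {V : Type*} [NormedAddCommGroup V] (z : ℕ → V) (w : V) (e : ℕ → ℝ)
    (he : ∀ k, 0 ≤ e k) {c K θ ρ : ℝ} (hc : 0 < c) (hK : 0 < K) (hθ : 1 / 2 ≤ θ ∧ θ < 1)
    (hdec : ∀ k, c * ‖z k - z (k + 1)‖ ^ 2 ≤ e k - e (k + 1))
    (hkl : ∀ k, ‖z k - w‖ ≤ ρ → e k ^ θ ≤ K * ‖z k - z (k + 1)‖)
    (hρ : K / (c * (1 - θ)) * e 0 ^ (1 - θ) + ‖z 0 - w‖ < ρ) :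
    (∀ k, ‖z k - w‖ ≤ ρ) ∧ ∀ N : ℕ, ∑ k ∈ Finset.range N, ‖z k - z (k + 1)‖ ≤
      K / (c * (1 - θ)) * e 0 ^ (1 - θ) := by
  have h1θ : 0 < 1 - θ := by linarith [hθ.2]
  have hcoef : 0 < K / (c * (1 - θ)) := by positivity
  have htri : ∀ N, ‖z N - w‖ ≤ ∑ k ∈ Finset.range N, ‖z k - z (k + 1)‖ + ‖z 0 - w‖ := by
    intro N
    induction N with
    | zero => simp
    | succ k ih =>
      rw [Finset.sum_range_succ]
      have := norm_sub_le_norm_sub_add_norm_sub (z (k+1)) (z k) w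
      rw [norm_sub_rev (z (k+1)) (z k)] at this
      linarith
  have key : ∀ N, ∑ k ∈ Finset.range N, ‖z k - z (k + 1)‖ ≤
      K / (c * (1 - θ)) * (e 0 ^ (1 - θ) - e N ^ (1 - θ)) := by
    intro N
    induction N with
    | zero => simp
    | succ k ih =>
      have h0 : 0 ≤ K / (c * (1 - θ)) * e k ^ (1 - θ) :=
        mul_nonneg hcoef.le (Real.rpow_nonneg (he k) _)
      have hb : ‖z k - w‖ ≤ ρ := by linarith [htri k]
      have := kl_scalar (he (k+1)) (hdec k) hc (norm_nonneg _) hK hθ (hkl k hb)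
      rw [Finset.sum_range_succ]
      linarith
  have key2 : ∀ N, ∑ k ∈ Finset.range N, ‖z k - z (k + 1)‖ ≤
      K / (c * (1 - θ)) * e 0 ^ (1 - θ) := by
    intro N
    have h0 : 0 ≤ K / (c * (1 - θ)) * e N ^ (1 - θ) :=
      mul_nonneg hcoef.le (Real.rpow_nonneg (he N) _)
    linarith [key N]
  exact ⟨fun k => by linarith [htri k, key2 k], key2⟩

/-- Under the Kurdyka–Łojasiewicz inequality near a limit point, the LRQD iterates
stay within a ball around the limit point and the successive differences have
finite total length. -/
theorem KL_finite_length {m r n : ℕ}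
    (D : Matrix (Fin m) (Fin n) ℍ[ℝ]) (Ω : Set (Fin m × Fin n)) [DecidablePred (· ∈ Ω)]
    (lam : ℝ) (hlam : 0 < lam)
    (A : ℕ → Matrix (Fin m) (Fin r) ℍ[ℝ]) (B : ℕ → Matrix (Fin r) (Fin n) ℍ[ℝ])
    (X : ℕ → Matrix (Fin m) (Fin n) ℍ[ℝ])
    (hXin : ∀ k, ∀ p ∈ Ω, X k p.1 p.2 = D p.1 p.2)
    (hXout : ∀ k, ∀ p : Fin m × Fin n, p ∉ Ω → X k p.1 p.2 = (A k * B k) p.1 p.2)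
    (hA : ∀ k, A (k + 1) = (X k * (B k)ᴴ + lam • A k) *
      Ring.inverse (B k * (B k)ᴴ + lam • (1 : Matrix (Fin r) (Fin r) ℍ[ℝ])))
    (hB : ∀ k, B (k + 1) =
      Ring.inverse ((A (k + 1))ᴴ * A (k + 1) + lam • (1 : Matrix (Fin r) (Fin r) ℍ[ℝ])) *
      ((A (k + 1))ᴴ * X k + lam • B k))
    (Asharp : Matrix (Fin m) (Fin r) ℍ[ℝ]) (Bsharp : Matrix (Fin r) (Fin n) ℍ[ℝ])
    (Xsharp : Matrix (Fin m) (Fin n) ℍ[ℝ])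
    (hlimpt : ∃ φ : ℕ → ℕ, StrictMono φ ∧
      Tendsto (fun i => tnorm (A (φ i) - Asharp) (B (φ i) - Bsharp) (X (φ i) - Xsharp))
        atTop (nhds 0))
    (η : ℝ) (hη : 0 < η)
    (hstep : ∀ k, tnorm (A k - A (k + 1)) (B k - B (k + 1)) (X k - X (k + 1)) ≥
      η * pgnorm Ω (A k) (B k) (X k))
    (θ μ ρ : ℝ) (hθ : 1 / 2 ≤ θ ∧ θ < 1) (hμ : 0 < μ) (hρ : 0 < ρ)
    (hKL : ∀ (A' : Matrix (Fin m) (Fin r) ℍ[ℝ]) (B' : Matrix (Fin r) (Fin n) ℍ[ℝ])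
      (X' : Matrix (Fin m) (Fin n) ℍ[ℝ]), (∀ p ∈ Ω, X' p.1 p.2 = D p.1 p.2) →
      tnorm (A' - Asharp) (B' - Bsharp) (X' - Xsharp) ≤ ρ →
      |(1 / 2) * frob (A' * B' - X') ^ 2 -
        (1 / 2) * frob (Asharp * Bsharp - Xsharp) ^ 2| ^ θ ≤ μ * pgnorm Ω A' B' X')
    (hρ2 : ρ > (2 * μ / (min lam 1 * η * (1 - θ))) *
        |(1 / 2) * frob (A 0 * B 0 - X 0) ^ 2 -
          (1 / 2) * frob (Asharp * Bsharp - Xsharp) ^ 2| ^ (1 - θ) +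
      tnorm (A 0 - Asharp) (B 0 - Bsharp) (X 0 - Xsharp)) :
    (∀ k, tnorm (A k - Asharp) (B k - Bsharp) (X k - Xsharp) ≤ ρ) ∧
    ∀ N : ℕ, ∑ k ∈ Finset.range N,
        tnorm (A k - A (k + 1)) (B k - B (k + 1)) (X k - X (k + 1)) ≤
      (2 * μ / (min lam 1 * η * (1 - θ))) *
        |(1 / 2) * frob (A 0 * B 0 - X 0) ^ 2 -
          (1 / 2) * frob (Asharp * Bsharp - Xsharp) ^ 2| ^ (1 - θ) := by
  obtain ⟨φ, hφ, hlim⟩ := hlimpt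
  have hl0 : 0 < min lam 1 := lt_min hlam one_pos
  have h1θ : 0 < 1 - θ := by linarith [hθ.2]
  set F : ℕ → ℝ := fun k => (1 / 2) * frob (A k * B k - X k) ^ 2 with hF
  set fs : ℝ := (1 / 2) * frob (Asharp * Bsharp - Xsharp) ^ 2 with hfs
  have hdec : ∀ k, min lam 1 / 2 * tnorm (A k - A (k + 1)) (B k - B (k + 1)) (X k - X (k + 1)) ^ 2
      ≤ F k - F (k + 1) := by
    intro k
    have a := decA _ _ _ _ lam hlam (hA k)
    have b := decB _ _ _ _ lam hlam (hB k)
    have c := decX D Ω (A (k+1) * B (k+1)) (X k) (X (k+1)) (hXin k) (hXin (k+1)) (hXout (k+1))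
    have ht : tnorm (A k - A (k + 1)) (B k - B (k + 1)) (X k - X (k + 1)) ^ 2 =
      frob (A k - A (k + 1)) ^ 2 + frob (B k - B (k + 1)) ^ 2 + frob (X k - X (k + 1)) ^ 2 :=
      Real.sq_sqrt (by positivity)
    rw [ht]
    simp only [hF]
    have l1 := min_le_left lam 1
    have l2 := min_le_right lam 1
    have m1 := mul_le_mul_of_nonneg_right l1 (sq_nonneg (frob (A k - A (k + 1))))
    have m2 := mul_le_mul_of_nonneg_right l1 (sq_nonneg (frob (B k - B (k + 1))))
    have m3 := mul_le_mul_of_nonneg_right l2 (sq_nonneg (frob (X k - X (k + 1))))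
    have p1 := mul_nonneg hlam.le (sq_nonneg (frob (A k - A (k + 1))))
    have p2 := mul_nonneg hlam.le (sq_nonneg (frob (B k - B (k + 1))))
    linarith
  have hanti : Antitone F := antitone_nat_of_succ_le fun k => by
    have := hdec k
    have h0 : 0 ≤ min lam 1 / 2 *
      tnorm (A k - A (k + 1)) (B k - B (k + 1)) (X k - X (k + 1)) ^ 2 := by positivity
    linarith
  have hv : Tendsto (fun i => tvec (A (φ i)) (B (φ i)) (X (φ i))) atTop
      (nhds (tvec Asharp Bsharp Xsharp)) := by
    rw [tendsto_iff_norm_sub_tendsto_zero]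
    simpa only [tnorm_eq, tvec_sub] using hlim
  have hvi : ∀ p, Tendsto (fun i => (tvec (A (φ i)) (B (φ i)) (X (φ i))) p) atTop
      (nhds ((tvec Asharp Bsharp Xsharp) p)) := fun p =>
    ((PiLp.continuous_apply 2 _ p).tendsto _).comp hv
  have hFlim : Tendsto (fun i => F (φ i)) atTop (nhds fs) := by
    simp only [hF, hfs, frob_sq, Matrix.sub_apply, Matrix.mul_apply]
    refine Tendsto.const_mul _ (tendsto_finsetSum _ fun i _ => tendsto_finsetSum _ fun j _ => ?_)
    refine Tendsto.pow (Tendsto.norm (Tendsto.sub (tendsto_finsetSum _ fun k _ => ?_) ?_)) 2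
    · exact (hvi (Sum.inl (i, k))).mul (hvi (Sum.inr (Sum.inl (k, j))))
    · exact hvi (Sum.inr (Sum.inr (i, j)))
  have hge : ∀ k, fs ≤ F k := fun k =>
    le_of_tendsto hFlim (eventually_atTop.2 ⟨k, fun i hi => hanti (hi.trans (hφ.le_apply))⟩)
  have habs : ∀ k, |F k - fs| = F k - fs := fun k => abs_of_nonneg (sub_nonneg.2 (hge k))
  have hcoef : 2 * μ / (min lam 1 * η * (1 - θ)) = (μ / η) / (min lam 1 / 2 * (1 - θ)) := by
    field_simp
  have h00 : |(1 / 2) * frob (A 0 * B 0 - X 0) ^ 2 - fs| = F 0 - fs := habs 0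
  rw [h00, hcoef] at hρ2 ⊢
  have main := kl_abstract (fun k => tvec (A k) (B k) (X k)) (tvec Asharp Bsharp Xsharp)
    (fun k => F k - fs) (fun k => sub_nonneg.2 (hge k)) (c := min lam 1 / 2) (K := μ / η) (θ := θ)
    (ρ := ρ) (by positivity) (by positivity) hθ
    (fun k => by
      have := hdec k
      rw [tnorm_eq, tvec_sub] at this
      linarith)
    (fun k hk => by
      rw [← tvec_sub, ← tnorm_eq] at hk ⊢
      have h1 := hKL _ _ _ (hXin k) hk
      have h2 : |(1 / 2) * frob (A k * B k - X k) ^ 2 - fs| = F k - fs := habs k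
      rw [h2] at h1
      refine h1.trans ?_
      rw [div_mul_eq_mul_div, le_div_iff₀ hη]
      have := mul_le_mul_of_nonneg_left (hstep k) hμ.le
      linarith)
    (by
      rw [← tvec_sub, ← tnorm_eq]
      exact hρ2)
  simpa only [← tvec_sub, ← tnorm_eq] using main
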